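/- Let α > 3 and c > 0. Let H be a real Hilbert space, f : H → ℝ convex and differentiable with ∇f Lipschitz continuous on bounded sets, argmin f nonempty, and let x* be the element of minimum norm of argmin f. Let (x_k)_{k ≥ 0} be a sequence in H satisfying, for all k ≥ 1, the implicit recursion (x_{k+1} − 2x_k + x_{k−1}) + (α/k)(x_k − x_{k−1}) + ∇f(x_{k+1}) + (c/k²) x_k = 0. Then liminf_{k → ∞} ‖x_k − x*‖ = 0. Moreover, if there exists k₀ such that either ‖x_k‖ < ‖x*‖ for all k ≥ k₀, or ‖x_k‖ ≥ ‖x*‖ for all k ≥ k₀, then x_k converges strongly to x* as k → ∞. -/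

import Mathlib

open Filter Set

section

variable {H : Type*} [NormedAddCommGroup H] [InnerProductSpace ℝ H]

/-- The gradient inequality for convex functions. -/
lemma ConvexOn.add_inner_gradient_le [CompleteSpace H] {f : H → ℝ} (hf : ConvexOn ℝ Set.univ f)
    {g u : H} (hg : HasGradientAt f g u) (v : H) : f u + inner ℝ g (v - u) ≤ f v := by
  have hline : HasDerivAt (f ∘ AffineMap.lineMap (k := ℝ) u v) (inner ℝ g (v - u)) 0 := by
    have h := hg.hasFDerivAt
    rw [← AffineMap.lineMap_apply_zero (k := ℝ) u v] at h
    simpa using h.comp_hasDerivAt (0 : ℝ) AffineMap.hasDerivAt_lineMap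
  have hconv : ConvexOn ℝ Set.univ (f ∘ AffineMap.lineMap (k := ℝ) u v) := by
    simpa using hf.comp_affineMap (AffineMap.lineMap (k := ℝ) u v)
  have h := hconv.le_slope_of_hasDerivAt (mem_univ 0) (mem_univ 1) one_pos hline
  simp [slope_def_field] at h
  linarith

/-- Points of norm at most `‖s‖` along which a convex function tends to its minimum converge to
the minimizer `s` of minimal norm. -/
lemma tendsto_minimal_norm_minimizer [CompleteSpace H] {f : H → ℝ} (hf : ConvexOn ℝ Set.univ f)
    (hcont : Continuous f) {s : H} (hs : ∀ y, f s ≤ f y)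
    (hs_norm : ∀ y, (∀ z, f y ≤ f z) → ‖s‖ ≤ ‖y‖) {ι : Type*} {l : Filter ι} {u : ι → H}
    (hu : Tendsto (fun i => f (u i)) l (nhds (f s))) (hu_norm : ∀ᶠ i in l, ‖u i‖ ≤ ‖s‖) :
    Tendsto u l (nhds s) := by
  set S : ℕ → Set H := fun n => {y | f y ≤ f s + 1 / ((n : ℝ) + 1)} with hS
  have hSconv (n : ℕ) : Convex ℝ (S n) := by
    simpa [hS] using hf.convex_le (f s + 1 / ((n : ℝ) + 1))
  have hSclosed (n : ℕ) : IsClosed (S n) := isClosed_le hcont continuous_const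
  have hsS (n : ℕ) : s ∈ S n := by
    have : (0 : ℝ) < 1 / ((n : ℝ) + 1) := by positivity
    simp only [hS, mem_ofPred_eq]; linarith
  have hSanti : Antitone S := by
    intro m n hmn y hy
    have h : 1 / ((n : ℝ) + 1) ≤ 1 / ((m : ℝ) + 1) := by gcongr
    simp only [hS, mem_ofPred_eq] at hy ⊢
    linarith
  have hproj (n : ℕ) : ∃ p ∈ S n, ∀ w ∈ S n, ‖w - p‖ ^ 2 ≤ ‖w‖ ^ 2 - ‖p‖ ^ 2 := by
    obtain ⟨p, hp, hpmin⟩ :=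
      exists_norm_eq_iInf_of_complete_convex ⟨s, hsS n⟩ (hSclosed n).isComplete (hSconv n) (0 : H)
    refine ⟨p, hp, fun w hw => ?_⟩
    have h := (norm_eq_iInf_iff_real_inner_le_zero (hSconv n) hp).1 hpmin w hw
    simp only [zero_sub, inner_neg_left, inner_sub_right, real_inner_self_eq_norm_sq] at h
    rw [norm_sub_sq_real, real_inner_comm]
    linarith
  choose p hpS hp using hproj
  have hple (n : ℕ) : ‖p n‖ ^ 2 ≤ ‖s‖ ^ 2 := by
    have := hp n s (hsS n)
    nlinarith [sq_nonneg ‖s - p n‖]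
  have hpmono : Monotone fun n => ‖p n‖ ^ 2 := by
    intro m n hmn
    have := hp m (p n) (hSanti hmn (hpS n))
    dsimp only
    nlinarith [sq_nonneg ‖p n - p m‖]
  have hpcauchy : CauchySeq p := by
    have hc := (tendsto_atTop_ciSup hpmono ⟨‖s‖ ^ 2, by rintro _ ⟨n, rfl⟩; exact hple n⟩).cauchySeq
    rw [Metric.cauchySeq_iff'] at hc ⊢
    intro ε hε
    obtain ⟨N, hN⟩ := hc (ε ^ 2) (by positivity)
    refine ⟨N, fun n hn => ?_⟩
    have h1 := hp N (p n) (hSanti hn (hpS n))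
    have h2 := hN n hn
    rw [Real.dist_eq] at h2
    rw [dist_eq_norm]
    exact lt_of_pow_lt_pow_left₀ 2 hε.le (by linarith [le_abs_self (‖p n‖ ^ 2 - ‖p N‖ ^ 2)])
  obtain ⟨q, hq⟩ := cauchySeq_tendsto_of_complete hpcauchy
  have hqmin (z : H) : f q ≤ f z := by
    have h1 : Tendsto (fun n : ℕ => f s + 1 / ((n : ℝ) + 1)) atTop (nhds (f s + 0)) :=
      tendsto_const_nhds.add tendsto_one_div_add_atTop_nhds_zero_nat
    have h2 : f q ≤ f s + 0 :=
      le_of_tendsto_of_tendsto' ((hcont.tendsto q).comp hq) h1 fun n => hpS n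
    linarith [hs z]
  have hps : Tendsto (fun n => ‖s‖ ^ 2 - ‖p n‖ ^ 2) atTop (nhds (‖s‖ ^ 2 - ‖q‖ ^ 2)) :=
    tendsto_const_nhds.sub (hq.norm.pow 2)
  have hqle : ‖s‖ ^ 2 - ‖q‖ ^ 2 ≤ 0 := by
    have := hs_norm q hqmin
    nlinarith [norm_nonneg s]
  have hqs : q = s := by
    have h : ‖s - q‖ ^ 2 ≤ ‖s‖ ^ 2 - ‖q‖ ^ 2 :=
      le_of_tendsto_of_tendsto' ((tendsto_const_nhds.sub hq).norm.pow 2) hps fun n => hp n s (hsS n)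
    have h0 : ‖s - q‖ = 0 := by
      have := sq_nonneg ‖s - q‖
      exact pow_eq_zero_iff (two_ne_zero) |>.1 (by linarith)
    exact (sub_eq_zero.1 (norm_eq_zero.1 h0)).symm
  subst hqs
  rw [Metric.tendsto_nhds]
  intro ε hε
  have hN1 : ∀ᶠ n in atTop, ‖q‖ ^ 2 - ‖p n‖ ^ 2 < (ε / 2) ^ 2 :=
    hps.eventually_lt_const (by simp; positivity)
  have hN2 : ∀ᶠ n in atTop, dist (p n) q < ε / 2 := Metric.tendsto_nhds.1 hq _ (by positivity)
  obtain ⟨n, hn1, hn2⟩ := (hN1.and hN2).exists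
  have hev : ∀ᶠ i in l, f (u i) < f q + 1 / ((n : ℝ) + 1) :=
    hu.eventually_lt_const (by have : (0 : ℝ) < 1 / ((n : ℝ) + 1) := by positivity
                               linarith)
  filter_upwards [hev, hu_norm] with i hi hin
  have h1 := hp n (u i) hi.le
  have h2 : ‖u i‖ ^ 2 ≤ ‖q‖ ^ 2 := by gcongr
  have h3 : ‖u i - p n‖ < ε / 2 := lt_of_pow_lt_pow_left₀ 2 (by positivity) (by linarith)
  calc dist (u i) q ≤ dist (u i) (p n) + dist (p n) q := dist_triangle _ _ _
    _ < ε / 2 + ε / 2 := by rw [dist_eq_norm]; exact add_lt_add h3 hn2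
    _ = ε := by ring

/-- A nonnegative sequence with relative decrease at least `1 / (M k)` tends to zero. -/
lemma tendsto_zero_of_succ_le_sub_div {a : ℕ → ℝ} {M : ℝ} (hM : 0 < M)
    (ha : ∀ᶠ k in atTop, 0 ≤ a k)
    (hstep : ∀ᶠ k : ℕ in atTop, a (k + 1) ≤ a k - a k / (M * k)) :
    Tendsto a atTop (nhds 0) := by
  set h : ℕ → ℝ := fun k => ∑ j ∈ Finset.range k, 1 / (j : ℝ) with hh
  have hnonneg (k : ℕ) : 0 ≤ h k := Finset.sum_nonneg fun j _ => by positivity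
  have htop : Tendsto (fun k => M + h k) atTop atTop :=
    tendsto_atTop_add_const_left _ _ ((not_summable_iff_tendsto_nat_atTop_of_nonneg
      fun j => by positivity).1 Real.not_summable_one_div_natCast)
  obtain ⟨K, hK⟩ := eventually_atTop.1 ((ha.and hstep).and (eventually_ge_atTop 1))
  have hbound (k : ℕ) (hk : K ≤ k) : a k * (M + h k) ≤ a K * (M + h K) := by
    induction k, hk using Nat.le_induction with
    | base => exact le_rfl
    | succ k hk ih =>
      obtain ⟨⟨h0, h1⟩, hk1⟩ := hK k hk
      have hkpos : (0 : ℝ) < k := by exact_mod_cast hk1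
      have hsucc : h (k + 1) = h k + 1 / (k : ℝ) := by simp [hh, Finset.sum_range_succ]
      refine le_trans ?_ ih
      have hle : a (k + 1) ≤ a k * (1 - 1 / (M * k)) := by
        rw [mul_sub, mul_one, mul_one_div]; exact h1
      have hfac : (1 - 1 / (M * k)) * (M + h k + 1 / k) ≤ M + h k := by
        have e : (1 - 1 / (M * k)) * (M + h k + 1 / k) =
            M + h k - h k / (M * k) - 1 / (M * k * k) := by field_simp; ring
        have e1 : 0 ≤ h k / (M * k) := div_nonneg (hnonneg k) (by positivity)
        have e2 : 0 ≤ 1 / (M * k * k) := by positivity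
        linarith
      have hpos : 0 ≤ M + h k + 1 / (k : ℝ) := by
        have := hnonneg k
        positivity
      calc a (k + 1) * (M + h (k + 1)) ≤ a k * (1 - 1 / (M * k)) * (M + h k + 1 / k) := by
            rw [hsucc, ← add_assoc]; exact mul_le_mul_of_nonneg_right hle hpos
        _ = a k * ((1 - 1 / (M * k)) * (M + h k + 1 / k)) := by ring
        _ ≤ a k * (M + h k) := mul_le_mul_of_nonneg_left hfac h0
  refine tendsto_of_tendsto_of_tendsto_of_le_of_le' tendsto_const_nhds
    (tendsto_const_nhds.div_atTop htop) ha (h := fun k => a K * (M + h K) / (M + h k)) ?_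
  filter_upwards [eventually_ge_atTop K] with k hk
  rw [le_div_iff₀ (by linarith [hnonneg k])]
  exact hbound k hk

/-- Exact change of the quadratic part of the energy along one step of the recursion. -/
lemma quadratic_energy_identity {s y d e g : H} {t b γ c : ℝ} (ht : t ≠ 0)
    (hg : t • e + (b + 1 + γ) • d + t • g + (c / t) • (y + s) = 0) :
    1 / 2 * ‖b • y + t • (d + e)‖ ^ 2 + c / 2 * ‖y + (d + e) + s‖ ^ 2 + γ * b / 2 * ‖y‖ ^ 2 =
      1 / 2 * ‖b • (y - d) + (t - 1) • d‖ ^ 2 + c / 2 * ‖y + s‖ ^ 2 + γ * b / 2 * ‖y - d‖ ^ 2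
        - t * inner ℝ g (b • y + t • (d + e))
        - b * c / (2 * t) * (‖y + s‖ ^ 2 + ‖y‖ ^ 2 - ‖s‖ ^ 2)
        + c / 2 * ‖d + e‖ ^ 2 - γ * b / 2 * ‖d‖ ^ 2 - γ * t * inner ℝ d (d + e)
        - 1 / 2 * ‖(b + 1) • d + t • e‖ ^ 2 := by
  have hinner (w : H) : t * inner ℝ g w =
      -(t * inner ℝ e w + (b + 1 + γ) * inner ℝ d w + c / t * (inner ℝ y w + inner ℝ s w)) := by
    have h := congrArg (fun z => inner ℝ z w) hg
    simp only [inner_add_left, real_inner_smul_left, inner_zero_left] at h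
    linarith
  rw [hinner]
  simp only [← real_inner_self_eq_norm_sq, inner_add_left, inner_add_right, inner_sub_left,
    inner_sub_right, real_inner_smul_left, real_inner_smul_right]
  rw [real_inner_comm d y, real_inner_comm d s, real_inner_comm e y, real_inner_comm e s,
    real_inner_comm e d, real_inner_comm y s]
  field_simp
  ring

lemma velocity_terms_le {d e : H} {t b γ c : ℝ} (ht : 0 < t) (hb : 0 ≤ b) (hγ : 0 < γ)
    (ht1 : 2 * γ ≤ t) (ht2 : c ≤ γ * t) (ht3 : 2 * (b + 1) ≤ t) :
    c / 2 * ‖d + e‖ ^ 2 - γ * b / 2 * ‖d‖ ^ 2 - γ * t * inner ℝ d (d + e)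
        - 1 / 2 * ‖(b + 1) • d + t • e‖ ^ 2 ≤ -(γ * t / 4 * ‖d‖ ^ 2) := by
  have hpol : inner ℝ d (d + e) = (‖d‖ ^ 2 + ‖d + e‖ ^ 2 - ‖e‖ ^ 2) / 2 := by
    rw [norm_add_sq_real, inner_add_right, real_inner_self_eq_norm_sq]; ring
  have hyoung : t ^ 2 * ‖e‖ ^ 2 ≤
      2 * ‖(b + 1) • d + t • e‖ ^ 2 + 2 * (b + 1) ^ 2 * ‖d‖ ^ 2 := by
    have h := sq_nonneg ‖(2 * (b + 1)) • d + t • e‖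
    rw [norm_add_sq_real, norm_smul, norm_smul, mul_pow, mul_pow, Real.norm_eq_abs,
      Real.norm_eq_abs, sq_abs, sq_abs, real_inner_smul_left] at h
    rw [norm_add_sq_real, norm_smul, norm_smul, mul_pow, mul_pow, Real.norm_eq_abs,
      Real.norm_eq_abs, sq_abs, sq_abs, real_inner_smul_left]
    linarith
  rw [hpol]
  set A := ‖d‖ ^ 2 with hA
  set B := ‖d + e‖ ^ 2
  set C := ‖e‖ ^ 2
  set D := ‖(b + 1) • d + t • e‖ ^ 2
  have hA0 : 0 ≤ A := sq_nonneg _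
  have hB0 : 0 ≤ B := sq_nonneg _
  have hD0 : 0 ≤ D := sq_nonneg _
  have h1 : γ * t / 2 * C ≤ 1 / 2 * D + γ * t / 4 * A := by
    have e1 : t * (γ * t / 2 * C) ≤ t * (1 / 2 * D + γ * t / 4 * A) := by
      have e2 : γ * D ≤ t / 2 * D := by gcongr; linarith
      have e3 : (b + 1) ^ 2 * (γ * A) ≤ (t / 2) ^ 2 * (γ * A) := by gcongr; linarith
      have e4 := mul_le_mul_of_nonneg_left hyoung hγ.le
      nlinarith
    exact le_of_mul_le_mul_left e1 ht
  have h2 : c * B ≤ γ * t * B := by gcongr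
  have h3 : 0 ≤ γ * b / 2 * A := by positivity
  nlinarith

/-- Discrete Lyapunov energy of the inertial proximal iteration with Tikhonov regularization. -/
noncomputable def ipatreEnergy (f : H → ℝ) (s : H) (b γ c : ℝ) (x : ℕ → H) (k : ℕ) : ℝ :=
  ((k : ℝ) - 1) ^ 2 * (f (x k) - f s) + c / 2 * ‖x k‖ ^ 2
    + 1 / 2 * ‖b • (x (k - 1) - s) + ((k : ℝ) - 1) • (x k - x (k - 1))‖ ^ 2
    + γ * b / 2 * ‖x (k - 1) - s‖ ^ 2

lemma ipatreEnergy_succ_le [CompleteSpace H] {f : H → ℝ} {f' : H → H}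
    (hconv : ConvexOn ℝ Set.univ f) (hgrad : ∀ y, HasGradientAt f (f' y) y) {s : H}
    (hs : ∀ y, f s ≤ f y) {b γ c : ℝ} (hb : 2 < b) (hγ : 0 < γ) {x : ℕ → H} {k : ℕ} (hk : 1 ≤ k)
    (hrec : (x (k + 1) - (2 : ℝ) • x k + x (k - 1)) + ((b + 1 + γ) / k) • (x k - x (k - 1)) +
        f' (x (k + 1)) + (c / (k : ℝ) ^ 2) • x k = 0)
    (hk1 : 2 * γ ≤ k) (hk2 : c ≤ γ * k) (hk3 : 2 * (b + 1) ≤ k) :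
    ipatreEnergy f s b γ c x (k + 1) + (b - 2) * k * (f (x k) - f s)
        + γ * k / 4 * ‖x k - x (k - 1)‖ ^ 2
        + b * c / (2 * k) * (‖x k‖ ^ 2 + ‖x k - s‖ ^ 2 - ‖s‖ ^ 2) ≤
      ipatreEnergy f s b γ c x k := by
  have ht : (0 : ℝ) < k := by exact_mod_cast hk
  set t : ℝ := (k : ℝ) with htdef
  set g := f' (x (k + 1)) with hgdef
  set d := x k - x (k - 1) with hd
  set e := x (k + 1) - (2 : ℝ) • x k + x (k - 1) with he
  set y := x k - s with hy
  have hde : x (k + 1) - x k = d + e := by rw [hd, he, two_smul]; abel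
  have hx1 : y + (d + e) + s = x (k + 1) := by rw [← hde, hy]; abel
  have hx0 : y + s = x k := by rw [hy]; abel
  have hxm : x (k - 1) - s = y - d := by rw [hy, hd]; abel
  have hscaled : t • e + (b + 1 + γ) • d + t • g + (c / t) • (y + s) = 0 := by
    have h := congrArg (fun z => t • z) hrec
    simp only [smul_add, smul_smul, smul_zero] at h
    rw [hx0]
    convert h using 4 <;> field_simp
  have hid := quadratic_energy_identity ht.ne' hscaled
  have hvel := velocity_terms_le (d := d) (e := e) ht (by linarith : 0 ≤ b) hγ hk1 hk2 hk3
  have hs1 : f (x (k + 1)) - f s ≤ inner ℝ g (y + (d + e)) := by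
    have h := hconv.add_inner_gradient_le (hgrad (x (k + 1))) s
    have e1 : s - x (k + 1) = -(y + (d + e)) := by rw [← hx1]; abel
    rw [e1, inner_neg_right] at h
    linarith
  have hs2 : f (x (k + 1)) - f (x k) ≤ inner ℝ g (d + e) := by
    have h := hconv.add_inner_gradient_le (hgrad (x (k + 1))) (x k)
    rw [← neg_sub, hde, inner_neg_right] at h
    linarith
  have hinner : inner ℝ g (b • y + t • (d + e)) =
      b * inner ℝ g (y + (d + e)) + (t - b) * inner ℝ g (d + e) := by
    simp only [inner_add_right, real_inner_smul_right]; ring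
  have hforce : t ^ 2 * (f (x (k + 1)) - f s) - t * (t - b) * (f (x k) - f s) ≤
      t * inner ℝ g (b • y + t • (d + e)) := by
    rw [hinner]
    have h1 := mul_le_mul_of_nonneg_left hs1 (by positivity : 0 ≤ t * b)
    have h2 := mul_le_mul_of_nonneg_left hs2 (mul_nonneg ht.le (by linarith : 0 ≤ t - b))
    linarith
  simp only [ipatreEnergy, Nat.add_sub_cancel, Nat.cast_add, Nat.cast_one, add_sub_cancel_right,
    ← htdef, ← hd, ← hy]
  rw [hxm, hde]
  rw [hx1, hx0] at hid
  have := hs (x k)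
  linarith

variable {f : H → ℝ} {f' : H → H} {s : H} {b γ c : ℝ} {x : ℕ → H}

lemma eventually_ipatreEnergy_succ_le [CompleteSpace H] (hconv : ConvexOn ℝ Set.univ f)
    (hgrad : ∀ y, HasGradientAt f (f' y) y) (hs : ∀ y, f s ≤ f y) (hb : 2 < b) (hγ : 0 < γ)
    (hrec : ∀ k : ℕ, 1 ≤ k →
      (x (k + 1) - (2 : ℝ) • x k + x (k - 1)) + ((b + 1 + γ) / k) • (x k - x (k - 1)) +
        f' (x (k + 1)) + (c / (k : ℝ) ^ 2) • x k = 0) :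
    ∀ᶠ k : ℕ in atTop, ipatreEnergy f s b γ c x (k + 1) + (b - 2) * k * (f (x k) - f s)
        + γ * k / 4 * ‖x k - x (k - 1)‖ ^ 2
        + b * c / (2 * k) * (‖x k‖ ^ 2 + ‖x k - s‖ ^ 2 - ‖s‖ ^ 2) ≤
      ipatreEnergy f s b γ c x k := by
  have hcast := tendsto_natCast_atTop_atTop (R := ℝ)
  filter_upwards [eventually_ge_atTop 1, hcast.eventually_ge_atTop (2 * γ),
    hcast.eventually_ge_atTop (c / γ), hcast.eventually_ge_atTop (2 * (b + 1))] with k hk h1 h2 h3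
  exact ipatreEnergy_succ_le hconv hgrad hs hb hγ hk (hrec k hk) h1
    (by rwa [div_le_iff₀' hγ] at h2) h3

lemma tendsto_value_of_ipatreEnergy (hs : ∀ y, f s ≤ f y) (hb : 2 < b) (hγ : 0 < γ) (hc : 0 < c)
    (hE : ∀ᶠ k : ℕ in atTop, ipatreEnergy f s b γ c x (k + 1) + (b - 2) * k * (f (x k) - f s)
        + γ * k / 4 * ‖x k - x (k - 1)‖ ^ 2
        + b * c / (2 * k) * (‖x k‖ ^ 2 + ‖x k - s‖ ^ 2 - ‖s‖ ^ 2) ≤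
      ipatreEnergy f s b γ c x k) :
    Tendsto (fun k => f (x k)) atTop (nhds (f s)) := by
  obtain ⟨K, hK⟩ := eventually_atTop.1 (hE.and (eventually_ge_atTop 1))
  set E := ipatreEnergy f s b γ c x with hEdef
  have hbc : 0 < b * c := mul_pos (by linarith) hc
  have hgrowth (k : ℕ) (hk : K ≤ k) : E k ≤ |E K| + b * c * ‖s‖ ^ 2 * k := by
    induction k, hk using Nat.le_induction with
    | base =>
      have : 0 ≤ b * c * ‖s‖ ^ 2 * K := by positivity
      linarith [le_abs_self (E K)]
    | succ k hk ih =>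
      obtain ⟨h, hk1⟩ := hK k hk
      have hk1' : (1 : ℝ) ≤ k := by exact_mod_cast hk1
      have h1 : 0 ≤ (b - 2) * k * (f (x k) - f s) :=
        mul_nonneg (mul_nonneg (by linarith) (by positivity)) (by linarith [hs (x k)])
      have h2 : 0 ≤ γ * k / 4 * ‖x k - x (k - 1)‖ ^ 2 := by positivity
      have h3 : 0 ≤ b * c / (2 * k) * (‖x k‖ ^ 2 + ‖x k - s‖ ^ 2) := by positivity
      have h4 : b * c / (2 * k) * ‖s‖ ^ 2 ≤ b * c * ‖s‖ ^ 2 := by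
        gcongr
        exact div_le_self hbc.le (by linarith)
      push_cast
      linarith
  have hlim : Tendsto (fun k : ℕ => f s + 4 * (|E K| + b * c * ‖s‖ ^ 2) / (k : ℝ)) atTop
      (nhds (f s)) := by
    simpa using tendsto_const_nhds (x := f s) |>.add
      (tendsto_const_div_atTop_nhds_zero_nat (4 * (|E K| + b * c * ‖s‖ ^ 2)))
  refine tendsto_of_tendsto_of_tendsto_of_le_of_le' tendsto_const_nhds hlim
    (Eventually.of_forall fun k => hs (x k)) ?_
  filter_upwards [eventually_ge_atTop K, eventually_ge_atTop 2] with k hkK hk2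
  have hk2' : (2 : ℝ) ≤ k := by exact_mod_cast hk2
  have hφ : 0 ≤ f (x k) - f s := by linarith [hs (x k)]
  have h1 : ((k : ℝ) - 1) ^ 2 * (f (x k) - f s) ≤ E k := by
    have hb0 : 0 < b := by linarith
    have : 0 ≤ c / 2 * ‖x k‖ ^ 2
      + 1 / 2 * ‖b • (x (k - 1) - s) + ((k : ℝ) - 1) • (x k - x (k - 1))‖ ^ 2
      + γ * b / 2 * ‖x (k - 1) - s‖ ^ 2 := by positivity
    simp only [hEdef, ipatreEnergy]
    linarith
  have h2 : (k / 2 : ℝ) ^ 2 * (f (x k) - f s) ≤ ((k : ℝ) - 1) ^ 2 * (f (x k) - f s) := by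
    gcongr; linarith
  have h3 : |E K| ≤ |E K| * k := le_mul_of_one_le_right (abs_nonneg _) (by linarith)
  have h4 : k * ((f (x k) - f s) * k) ≤ k * (4 * (|E K| + b * c * ‖s‖ ^ 2)) := by
    linarith [hgrowth k hkK]
  have h5 := le_of_mul_le_mul_left h4 (by linarith)
  rw [← le_div_iff₀ (by linarith)] at h5
  linarith

lemma tendsto_of_ipatreEnergy (hs : ∀ y, f s ≤ f y) (hb : 2 < b) (hγ : 0 < γ) (hc : 0 < c)
    (hE : ∀ᶠ k : ℕ in atTop, ipatreEnergy f s b γ c x (k + 1) + (b - 2) * k * (f (x k) - f s)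
        + γ * k / 4 * ‖x k - x (k - 1)‖ ^ 2
        + b * c / (2 * k) * (‖x k‖ ^ 2 + ‖x k - s‖ ^ 2 - ‖s‖ ^ 2) ≤
      ipatreEnergy f s b γ c x k)
    (hnorm : ∀ᶠ k in atTop, ‖s‖ ≤ ‖x k‖) :
    Tendsto x atTop (nhds s) := by
  have hb0 : 0 < b := by linarith
  have hb2 : 0 < b - 2 := by linarith
  set a : ℕ → ℝ := fun k => ipatreEnergy f s b γ c x k - c / 2 * ‖s‖ ^ 2 with ha
  set M : ℝ := 1 / (b - 2) + 4 * (1 + γ * b) / γ + (1 / b + 2 * (b ^ 2 + γ * b) / (b * c)) with hM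
  have hMpos : 0 < M := by positivity
  have hM1 : 1 ≤ M * (b - 2) := by
    rw [← div_le_iff₀ hb2, hM, add_assoc]
    exact le_add_of_nonneg_right (by positivity)
  have hM2 : 1 + γ * b ≤ M * (γ / 4) := by
    rw [← div_le_iff₀ (by positivity)]
    have e : (1 + γ * b) / (γ / 4) = 4 * (1 + γ * b) / γ := by field_simp
    have h1 : 0 < 1 / (b - 2) := by positivity
    have h2 : 0 < 1 / b + 2 * (b ^ 2 + γ * b) / (b * c) := by positivity
    rw [e, hM]; linarith
  have hM3 : 1 / b + 2 * (b ^ 2 + γ * b) / (b * c) ≤ M := by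
    have h1 : 0 < 1 / (b - 2) + 4 * (1 + γ * b) / γ := by positivity
    rw [hM]; linarith
  have hM4 : c / 2 ≤ M * (b * c / 2) := by
    rw [← div_le_iff₀ (by positivity)]
    have e : c / 2 / (b * c / 2) = 1 / b := by field_simp
    have h1 : 0 < 2 * (b ^ 2 + γ * b) / (b * c) := by positivity
    rw [e]; linarith
  have hM5 : b ^ 2 + γ * b ≤ M * (b * c / 2) := by
    rw [← div_le_iff₀ (by positivity)]
    have e : (b ^ 2 + γ * b) / (b * c / 2) = 2 * (b ^ 2 + γ * b) / (b * c) := by field_simp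
    have h1 : 0 < 1 / b := by positivity
    rw [e]; linarith
  have hlow : ∀ᶠ k in atTop, γ * b / 2 * ‖x (k - 1) - s‖ ^ 2 ≤ a k := by
    filter_upwards [hnorm] with k hk
    have h1 : ‖s‖ ^ 2 ≤ ‖x k‖ ^ 2 := by gcongr
    have h2 : 0 ≤ ((k : ℝ) - 1) ^ 2 * (f (x k) - f s) :=
      mul_nonneg (sq_nonneg _) (by linarith [hs (x k)])
    have h3 : 0 ≤ 1 / 2 * ‖b • (x (k - 1) - s) + ((k : ℝ) - 1) • (x k - x (k - 1))‖ ^ 2 := by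
      positivity
    have h4 := mul_le_mul_of_nonneg_left h1 hc.le
    simp only [ha, ipatreEnergy]
    linarith
  have hlim : Tendsto a atTop (nhds 0) := by
    refine tendsto_zero_of_succ_le_sub_div hMpos
      (hlow.mono fun k hk => le_trans (by positivity) hk) ?_
    filter_upwards [hE, hnorm, eventually_ge_atTop 1,
      tendsto_natCast_atTop_atTop.eventually_ge_atTop (b + 1)] with k hEk hk hk1 hkb
    have hk1' : (1 : ℝ) ≤ k := by exact_mod_cast hk1
    have hkpos : (0 : ℝ) < k := by linarith
    have hφ : 0 ≤ f (x k) - f s := by linarith [hs (x k)]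
    have hn : 0 ≤ ‖x k‖ ^ 2 - ‖s‖ ^ 2 := by
      have : ‖s‖ ^ 2 ≤ ‖x k‖ ^ 2 := by gcongr
      linarith
    have hv : 1 / 2 * ‖b • (x (k - 1) - s) + ((k : ℝ) - 1) • (x k - x (k - 1))‖ ^ 2 ≤
        b ^ 2 * ‖x k - s‖ ^ 2 + (k : ℝ) ^ 2 * ‖x k - x (k - 1)‖ ^ 2 := by
      have e : b • (x (k - 1) - s) + ((k : ℝ) - 1) • (x k - x (k - 1)) =
          b • (x k - s) + ((k : ℝ) - 1 - b) • (x k - x (k - 1)) := by module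
      have h1 : ‖b • (x k - s) + ((k : ℝ) - 1 - b) • (x k - x (k - 1))‖ ≤
          b * ‖x k - s‖ + k * ‖x k - x (k - 1)‖ := by
        refine (norm_add_le _ _).trans ?_
        rw [norm_smul, norm_smul, Real.norm_of_nonneg hb0.le,
          Real.norm_of_nonneg (by linarith : 0 ≤ (k : ℝ) - 1 - b)]
        gcongr
        linarith
      have h2 := pow_le_pow_left₀ (norm_nonneg _) h1 2
      rw [e]
      nlinarith [sq_nonneg (b * ‖x k - s‖ - k * ‖x k - x (k - 1)‖)]
    have hprev : ‖x (k - 1) - s‖ ^ 2 ≤ 2 * ‖x k - s‖ ^ 2 + 2 * ‖x k - x (k - 1)‖ ^ 2 := by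
      have h1 : ‖x (k - 1) - s‖ ≤ ‖x k - s‖ + ‖x k - x (k - 1)‖ := by
        rw [show x (k - 1) - s = (x k - s) - (x k - x (k - 1)) by abel]
        exact norm_sub_le _ _
      have h2 := pow_le_pow_left₀ (norm_nonneg _) h1 2
      nlinarith [sq_nonneg (‖x k - s‖ - ‖x k - x (k - 1)‖)]
    set φ := f (x k) - f s
    set V := ‖x k - x (k - 1)‖ ^ 2
    set Y := ‖x k - s‖ ^ 2
    have hV : 0 ≤ V := sq_nonneg _
    have hY : 0 ≤ Y := sq_nonneg _
    set D := (b - 2) * k * φ + γ * k / 4 * V + b * c / (2 * k) * (‖x k‖ ^ 2 + Y - ‖s‖ ^ 2) with hD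
    have hkD : M * k * D = M * (b - 2) * ((k : ℝ) ^ 2 * φ) + M * (γ / 4) * ((k : ℝ) ^ 2 * V) +
        M * (b * c / 2) * (‖x k‖ ^ 2 - ‖s‖ ^ 2) + M * (b * c / 2) * Y := by
      rw [hD]; field_simp; ring
    have hle : a k ≤ M * k * D := by
      have g1 : ((k : ℝ) - 1) ^ 2 * φ ≤ (k : ℝ) ^ 2 * φ := by
        gcongr; linarith
      have g2 := mul_le_mul_of_nonneg_right hM1 (mul_nonneg (sq_nonneg (k : ℝ)) hφ)
      have g3 := mul_le_mul_of_nonneg_right hM2 (mul_nonneg (sq_nonneg (k : ℝ)) hV)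
      have g4 := mul_le_mul_of_nonneg_right hM4 hn
      have g5 := mul_le_mul_of_nonneg_right hM5 hY
      have g6 := mul_le_mul_of_nonneg_left hprev (by positivity : 0 ≤ γ * b / 2)
      have g7 : γ * b * V ≤ γ * b * ((k : ℝ) ^ 2 * V) := by
        gcongr
        exact le_mul_of_one_le_left hV (one_le_pow₀ hk1')
      rw [hkD]
      simp only [ha, ipatreEnergy]
      linarith
    have hdiv : a k / (M * k) ≤ D := by
      rw [div_le_iff₀ (by positivity)]; linarith
    have hsucc : a (k + 1) + D ≤ a k := by
      simp only [ha, hD]; linarith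
    linarith
  have hsq : Tendsto (fun k => ‖x (k - 1) - s‖ ^ 2) atTop (nhds 0) := by
    have h := hlim.const_mul (2 / (γ * b))
    rw [mul_zero] at h
    refine tendsto_of_tendsto_of_tendsto_of_le_of_le' tendsto_const_nhds h
      (Eventually.of_forall fun k => sq_nonneg _) ?_
    filter_upwards [hlow] with k hk
    calc ‖x (k - 1) - s‖ ^ 2 = 2 / (γ * b) * (γ * b / 2 * ‖x (k - 1) - s‖ ^ 2) := by field_simp
      _ ≤ 2 / (γ * b) * a k := by gcongr
  have hsq' : Tendsto (fun k => ‖x k - s‖ ^ 2) atTop (nhds 0) := by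
    simpa [Function.comp_def] using hsq.comp (tendsto_add_atTop_nat 1)
  rw [tendsto_iff_norm_sub_tendsto_zero]
  simpa using hsq'.sqrt

end


/-- Strong convergence of (IPATRE) iterates towards the minimum norm solution
(Theorem 5.2). -/
theorem ipatre_strong_convergence
    {H : Type*} [NormedAddCommGroup H] [InnerProductSpace ℝ H] [CompleteSpace H]
    (f : H → ℝ) (f' : H → H)
    (hconv : ConvexOn ℝ Set.univ f)
    (hgrad : ∀ y, HasGradientAt f (f' y) y)
    (hlip : ∀ s : Set H, Bornology.IsBounded s → ∃ L : NNReal, LipschitzOnWith L f' s)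
    (xstar : H)
    (hxstar_min : ∀ y, f xstar ≤ f y)
    (hxstar_norm : ∀ y, (∀ z, f y ≤ f z) → ‖xstar‖ ≤ ‖y‖)
    (α c : ℝ) (hα : 3 < α) (hc : 0 < c)
    (x : ℕ → H)
    (hrec : ∀ k : ℕ, 1 ≤ k →
      (x (k + 1) - (2 : ℝ) • x k + x (k - 1)) + (α / k) • (x k - x (k - 1)) +
        f' (x (k + 1)) + (c / (k : ℝ) ^ 2) • x k = 0) :
    Filter.liminf (fun k : ℕ => ‖x k - xstar‖) atTop = 0 ∧
    ((∃ k₀ : ℕ,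
        (∀ k, k₀ ≤ k → ‖x k‖ < ‖xstar‖) ∨ (∀ k, k₀ ≤ k → ‖xstar‖ ≤ ‖x k‖)) →
      Tendsto x atTop (nhds xstar)) := by
  set b : ℝ := (α + 1) / 2 with hb_def
  set γ : ℝ := (α - 3) / 2 with hγ_def
  have hb : 2 < b := by rw [hb_def]; linarith
  have hγ : 0 < γ := by rw [hγ_def]; linarith
  have hα_eq : α = b + 1 + γ := by rw [hb_def, hγ_def]; ring
  have hE := eventually_ipatreEnergy_succ_le hconv hgrad hxstar_min hb hγ
    (by rw [← hα_eq]; exact hrec)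
  have hval := tendsto_value_of_ipatreEnergy hxstar_min hb hγ hc hE
  have hcont : Continuous f :=
    continuous_iff_continuousAt.2 fun y => (hgrad y).hasFDerivAt.continuousAt
  have hge : (∀ᶠ k in atTop, ‖xstar‖ ≤ ‖x k‖) → Tendsto x atTop (nhds xstar) :=
    tendsto_of_ipatreEnergy hxstar_min hb hγ hc hE
  have hlt : Tendsto x (atTop ⊓ 𝓟 {k | ‖x k‖ < ‖xstar‖}) (nhds xstar) :=
    tendsto_minimal_norm_minimizer hconv hcont hxstar_min hxstar_norm (hval.mono_left inf_le_left)
      (eventually_inf_principal.2 (Eventually.of_forall fun k hk => le_of_lt hk))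
  have hfreq (ε : ℝ) (hε : 0 < ε) : ∃ᶠ k in atTop, ‖x k - xstar‖ ≤ ε := by
    by_cases h : ∀ᶠ k in atTop, ‖xstar‖ ≤ ‖x k‖
    · refine ((Metric.tendsto_nhds.1 (hge h) ε hε).mono fun k hk => ?_).frequently
      rw [← dist_eq_norm]; exact hk.le
    · have hfr : ∃ᶠ k in atTop, ‖x k‖ < ‖xstar‖ := by
        simpa [Filter.Frequently, not_lt] using h
      have hev := eventually_inf_principal.1 (Metric.tendsto_nhds.1 hlt ε hε)
      refine (hfr.and_eventually hev).mono fun k hk => ?_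
      rw [← dist_eq_norm]; exact (hk.2 hk.1).le
  refine ⟨le_antisymm ?_ ?_, ?_⟩
  · refine le_of_forall_pos_le_add fun ε hε => ?_
    rw [zero_add]
    exact liminf_le_of_frequently_le (hfreq ε hε) (isBoundedUnder_of ⟨0, fun k => norm_nonneg _⟩)
  · exact le_liminf_of_le (IsCoboundedUnder.of_frequently_le (hfreq 1 one_pos))
      (Eventually.of_forall fun k => norm_nonneg _)
  · rintro ⟨k₀, h | h⟩
    · exact tendsto_minimal_norm_minimizer hconv hcont hxstar_min hxstar_norm hval
        (eventually_atTop.2 ⟨k₀, fun k hk => (h k hk).le⟩)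
    · exact hge (eventually_atTop.2 ⟨k₀, h⟩)
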